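/- Let T⃗ = (T_1,…,T_d) be a vector homogeneous tree, W a homogeneous tree with branching number b_W, 0 < ε ≤ 1 and D : ⊗T⃗ → 2^W an ε-dense level selection. Set Θ_n = |fan(T⃗,n)| and θ_n = ε/(2 b_W Θ_n) for n ≥ 1. Assume hypothesis (H): for every vector strong subtree R⃗ of T⃗, every w ∈ W and every 0 < θ ≤ 1, the pair (R⃗, w) is not strongly θ-correlated with respect to D. Then for every n ≥ 1 and every vector strong subtree S⃗ of T⃗ there exist a vector fan F⃗ of S⃗ with F⃗(0) equal to the root tuple of S⃗ and a map φ : D(F⃗(0)) → {0,…,b_W−1} such that for every w ∈ D(F⃗(0)), dens(⋂_{t⃗ ∈ ⊗F⃗(1)} D(t⃗) | w⌢_W φ(w)) ≤ θ_n. -/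

import Mathlib

open Filter

namespace DHLPaper

/-- The tree `b^{<ℕ}` of all finite sequences with values in `{0,…,b−1}`,
partially ordered by end-extension (`List.IsPrefix`, written `<+:`). -/
def bSeq (b : ℕ) : Set (List ℕ) := {t | ∀ x ∈ t, x < b}

/-- The set of successors of `t` in `T`: `Suc_T(t) = {s ∈ T : t ≤ s}`. -/
def suc (T : Set (List ℕ)) (t : List ℕ) : Set (List ℕ) := {s ∈ T | t <+: s}

/-- `s` is an immediate successor of `t` in `T`. -/
def ImmSuc (T : Set (List ℕ)) (t s : List ℕ) : Prop :=
  t ∈ T ∧ s ∈ T ∧ t <+: s ∧ t ≠ s ∧ ∀ u ∈ T, t <+: u → u <+: s → u = t ∨ u = s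

/-- The `n`-th level of `T`: the nodes of `T` with exactly `n` strict predecessors in `T`. -/
def level (T : Set (List ℕ)) (n : ℕ) : Set (List ℕ) :=
  {t ∈ T | {s ∈ T | s <+: t ∧ s ≠ t}.ncard = n}

/-- `T` has exactly one minimal node. -/
def UniquelyRooted (T : Set (List ℕ)) : Prop := ∃! r, r ∈ level T 0

/-- Every node of `T` has finitely many immediate successors in `T`. -/
def FinitelyBranching (T : Set (List ℕ)) : Prop := ∀ t ∈ T, {s | ImmSuc T t s}.Finite

/-- Every node of `T` has at least one immediate successor in `T`. -/
def Pruned (T : Set (List ℕ)) : Prop := ∀ t ∈ T, ∃ s, ImmSuc T t s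

/-- `S` is a strong subtree of `T` whose level set `L_T(S)` is enumerated by the strictly
increasing map `l`: `S(n) ⊆ T(l n)` for every `n`, `S` is uniquely rooted, and for every
`s ∈ S` and every immediate successor `t` of `s` in `T` there is a unique immediate
successor `s'` of `s` in `S` with `t ≤ s'`. -/
def IsStrongSubtreeWith (T S : Set (List ℕ)) (l : ℕ → ℕ) : Prop :=
  S ⊆ T ∧ UniquelyRooted S ∧ StrictMono l ∧
    (∀ n, level S n ⊆ level T (l n)) ∧
    (∀ s ∈ S, ∀ t, ImmSuc T s t → ∃! s', ImmSuc S s s' ∧ t <+: s')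

/-- `S` is a strong subtree of `T`. -/
def IsStrongSubtree (T S : Set (List ℕ)) : Prop := ∃ l, IsStrongSubtreeWith T S l

/-- A homogeneous tree with branching number `b`: a strong subtree of `b^{<ℕ}`, `b ≥ 2`. -/
def IsHomogeneous (b : ℕ) (T : Set (List ℕ)) : Prop := 2 ≤ b ∧ IsStrongSubtree (bSeq b) T

/-- A vector homogeneous tree: a `d`-tuple of homogeneous trees. -/
def IsVecHomogeneous {d : ℕ} (b : Fin d → ℕ) (T : Fin d → Set (List ℕ)) : Prop :=
  ∀ i, IsHomogeneous (b i) (T i)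

/-- Vector strong subtree: componentwise strong subtrees with a common level set. -/
def IsVecStrongSubtree {d : ℕ} (T S : Fin d → Set (List ℕ)) : Prop :=
  ∃ l, ∀ i, IsStrongSubtreeWith (T i) (S i) l

/-- `⊗T(n) = T_1(n) × ⋯ × T_d(n)`. -/
def vecLevel {d : ℕ} (T : Fin d → Set (List ℕ)) (n : ℕ) : Set (Fin d → List ℕ) :=
  {v | ∀ i, v i ∈ level (T i) n}

/-- The level product `⊗T = ⋃_n ⊗T(n)`. -/
def levelProd {d : ℕ} (T : Fin d → Set (List ℕ)) : Set (Fin d → List ℕ) :=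
  ⋃ n, vecLevel T n

/-- `r` is the root tuple of the vector tree `T`. -/
def IsRoot {d : ℕ} (T : Fin d → Set (List ℕ)) (r : Fin d → List ℕ) : Prop :=
  ∀ i, level (T i) 0 = {r i}

/-- `F` is a vector fan of `T`: `F = (R_1(0) ∪ R_1(1), …, R_d(0) ∪ R_d(1))` for some
vector strong subtree `R` of `T`. -/
def IsVecFan {d : ℕ} (T F : Fin d → Set (List ℕ)) : Prop :=
  ∃ R : Fin d → Set (List ℕ), IsVecStrongSubtree T R ∧
    ∀ i, F i = level (R i) 0 ∪ level (R i) 1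

/-- `fan(T,n)`: the vector fans of `T` with `⊗F(1) ⊆ ⊗T(n)`. -/
def fanAt {d : ℕ} (T : Fin d → Set (List ℕ)) (n : ℕ) : Set (Fin d → Set (List ℕ)) :=
  {F | IsVecFan T F ∧ vecLevel F 1 ⊆ vecLevel T n}

/-- Density of `F ⊆ W(n)` in the `n`-th level of `W`. -/
noncomputable def dens (W : Set (List ℕ)) (n : ℕ) (F : Set (List ℕ)) : ℝ :=
  (F.ncard : ℝ) / ((level W n).ncard : ℝ)

/-- Density of `F ⊆ W(n)` relative to the node `w`. -/
noncomputable def densRel (W : Set (List ℕ)) (n : ℕ) (F : Set (List ℕ)) (w : List ℕ) : ℝ :=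
  ((F ∩ suc W w).ncard : ℝ) / ((level W n ∩ suc W w).ncard : ℝ)

/-- `s = w ⌢_W p`: `s` is the immediate successor of `w` in `W` such that the
concatenation `w ⌢ p` is an initial segment of `s`. -/
def IsConcat (W : Set (List ℕ)) (w : List ℕ) (p : ℕ) (s : List ℕ) : Prop :=
  ImmSuc W w s ∧ w ++ [p] <+: s

/-- The density Halpern–Läuchli statement in dimension `d`. -/
def DHL (d : ℕ) : Prop :=
  ∀ (b : Fin d → ℕ) (T : Fin d → Set (List ℕ)), IsVecHomogeneous b T →
    ∀ D : Set (Fin d → List ℕ), D ⊆ levelProd T →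
      0 < Filter.limsup
          (fun n => ((D ∩ vecLevel T n).ncard : ℝ) / ((vecLevel T n).ncard : ℝ)) atTop →
      ∃ S : Fin d → Set (List ℕ), IsVecStrongSubtree T S ∧ levelProd S ⊆ D

/-- `D : ⊗T → 2^W` is an `ε`-dense level selection along the strictly increasing
sequence `l`: for every `n` and every `t⃗ ∈ ⊗T(n)`, `D(t⃗) ⊆ W(l n)` and
`dens(D(t⃗)) ≥ ε`. -/
def IsDenseLevelSel {d : ℕ} (T : Fin d → Set (List ℕ)) (W : Set (List ℕ)) (l : ℕ → ℕ)
    (ε : ℝ) (D : (Fin d → List ℕ) → Set (List ℕ)) : Prop :=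
  StrictMono l ∧ ∀ n, ∀ v ∈ vecLevel T n, D v ⊆ level W (l n) ∧ ε ≤ dens W (l n) (D v)

/-- The pair `(R, w)` (`R` a vector strong subtree of `T` with root tuple `r0`) is strongly
`θ`-correlated with respect to the dense level selection `D` (with level sequence `l`):
`w ∈ D(r0)` and for every vector fan `F` of `R` with `F(0) = r0` and every `p < b_W`,
`dens(⋂_{r ∈ ⊗F(1)} D(r) | w ⌢_W p) ≥ θ`. -/
def StronglyCorrelated {d : ℕ} (T : Fin d → Set (List ℕ)) (W : Set (List ℕ)) (bW : ℕ)
    (l : ℕ → ℕ) (D : (Fin d → List ℕ) → Set (List ℕ)) (R : Fin d → Set (List ℕ))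
    (r0 : Fin d → List ℕ) (w : List ℕ) (θ : ℝ) : Prop :=
  w ∈ D r0 ∧
    ∀ F : Fin d → Set (List ℕ), IsVecFan R F → IsRoot F r0 →
      ∀ n, vecLevel F 1 ⊆ vecLevel T n →
        ∀ p < bW, ∀ s, IsConcat W w p s →
          θ ≤ densRel W (l n) (⋂ r ∈ vecLevel F 1, D r) s

/-- In a compact right-topological semigroup there is an idempotent `p` generating a minimal
left ideal. -/
theorem exists_minimal_idempotent {M : Type*} [Semigroup M] [TopologicalSpace M] [CompactSpace M]
    [T2Space M] [Nonempty M] (hM : ∀ r : M, Continuous (· * r)) :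
    ∃ p : M, p * p = p ∧ ∀ x, ∃ z, z * (x * p) = p := by
  let I : Set (Set M) := {N | IsClosed N ∧ N.Nonempty ∧ ∀ m, ∀ x ∈ N, m * x ∈ N}
  obtain ⟨N, -, hN⟩ := zorn_superset_nonempty I (fun c hc hchain hne => by
    refine ⟨⋂₀ c, ⟨isClosed_sInter fun t ht => (hc ht).1, ?_, ?_⟩,
      fun s hs => Set.sInter_subset_of_mem hs⟩
    · have := hne.to_subtype
      exact IsCompact.nonempty_sInter_of_directed_nonempty_isCompact_isClosed
        (fun s hs t ht => (hchain.total hs ht).elim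
          (fun h => ⟨s, hs, subset_rfl, h⟩) fun h => ⟨t, ht, h, subset_rfl⟩) (fun t ht => (hc ht).2.1)
        (fun t ht => (hc ht).1.isCompact) (fun t ht => (hc ht).1)
    · intro m x hx t ht
      exact (hc ht).2.2 m x (hx t ht)) Set.univ ⟨isClosed_univ, Set.univ_nonempty, by simp⟩
  obtain ⟨hcl, hne, hmul⟩ := hN.prop
  obtain ⟨p, hp, hpp⟩ := exists_idempotent_in_compact_subsemigroup hM N hne hcl.isCompact
    (fun x _ y hy => hmul x y hy)
  refine ⟨p, hpp, fun x => ?_⟩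
  have hsub : Set.range (· * (x * p)) ⊆ N := by
    rintro _ ⟨m, rfl⟩
    exact hmul _ _ (hmul _ _ hp)
  have hmem : Set.range (· * (x * p)) ∈ I := by
    refine ⟨(isCompact_range (hM _)).isClosed, Set.range_nonempty _, ?_⟩
    rintro m _ ⟨y, rfl⟩
    exact ⟨m * y, mul_assoc _ _ _⟩
  exact hN.le_of_le hmem hsub hp

/-- Given homomorphisms `φ a` between compact right-topological semigroups that agree at some
point over a minimal idempotent `p`, each `i` has a right multiple `i * y` whose images
under the `φ a` are absorbed by `p` and by each other. -/
theorem exists_absorbed_multiple {A V M : Type*} [Semigroup V] [TopologicalSpace V]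
    [CompactSpace V] [T2Space V] (hV : ∀ r : V, Continuous (· * r)) [Semigroup M]
    (φ : A → V →ₙ* M) (p : M) (hpp : p * p = p) (hp : ∀ x, ∃ z, z * (x * p) = p)
    (P : V) (hP : ∀ a, φ a P = p) (i : V) :
    ∃ y, (∀ a, p * φ a (i * y) = p) ∧ ∀ a a', φ a (i * y) * φ a' (i * y) = φ a (i * y) := by
  have left_inverse : ∀ x : V, (∀ a, p * φ a x = φ a x) → (∀ a, φ a x * p = φ a x) →
      ∃ y, ∀ a, φ a y * φ a x = p ∧ p * φ a y = φ a y ∧ φ a y * p = φ a y := by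
    intro x hx hx'
    obtain ⟨_, ⟨e, rfl⟩, hu⟩ := exists_idempotent_in_compact_subsemigroup hV
      (Set.range (· * x)) ⟨x * x, x, rfl⟩ (isCompact_range (hV x))
      (by rintro _ ⟨m, rfl⟩ _ ⟨m', rfl⟩; exact ⟨m * x * m', mul_assoc _ _ _⟩)
    refine ⟨P * e * P, fun a => ⟨?_, ?_, ?_⟩⟩
    · have h1 := congrArg (φ a) hu
      simp only [map_mul] at h1
      obtain ⟨z, hz⟩ := hp (φ a e * φ a x)
      have h2 : φ a e * φ a x * p = φ a e * φ a x := by rw [mul_assoc, hx']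
      rw [h2] at hz
      simp only [map_mul, hP]
      rw [mul_assoc, hx, mul_assoc]
      calc p * (φ a e * φ a x) = z * ((φ a e * φ a x) * (φ a e * φ a x)) := by
            rw [← mul_assoc z, hz]
        _ = p := by rw [h1, hz]
    · simp only [map_mul, hP, ← mul_assoc, hpp]
    · simp only [map_mul, hP, mul_assoc, hpp]
  obtain ⟨y, hy⟩ := left_inverse (P * i * P)
    (fun a => by simp only [map_mul, hP, ← mul_assoc, hpp])
    (fun a => by simp only [map_mul, hP, mul_assoc, hpp])
  obtain ⟨z, hz⟩ := left_inverse y (fun a => (hy a).2.1) (fun a => (hy a).2.2)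
  have hxy : ∀ a, p * φ a i * p * φ a y = p := by
    intro a
    have hzx : φ a z = φ a (P * i * P) := by
      calc φ a z = φ a z * (φ a y * φ a (P * i * P)) := by rw [(hy a).1, (hz a).2.2]
        _ = p * φ a (P * i * P) := by rw [← mul_assoc, (hz a).1]
        _ = φ a (P * i * P) := by simp only [map_mul, hP, ← mul_assoc, hpp]
    have := (hz a).1
    rwa [hzx, map_mul, map_mul, hP] at this
  refine ⟨P * y, fun a => ?_, fun a a' => ?_⟩
  · simp only [map_mul, hP, ← mul_assoc]
    exact hxy a
  · simp only [map_mul, hP]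
    calc φ a i * (p * φ a y) * (φ a' i * (p * φ a' y))
        = φ a i * (p * (φ a y * p)) * (φ a' i * (p * φ a' y)) := by rw [(hy a).2.2]
      _ = φ a i * (p * (φ a y * (p * φ a' i * p * φ a' y))) := by simp only [mul_assoc]
      _ = φ a i * (p * φ a y) := by rw [hxy, (hy a).2.2]

/-- Substitute `x` for the variable `none` in a variable word, projecting the letters by `π`. -/
def substWord {A B : Type*} (π : A → B) (x : B) (y : List (Option A)) : List B :=
  y.map fun o => o.elim x π

/-- The concatenation of the words obtained by substituting the letters of a list in
consecutive variable words `y 0, y 1, …`. -/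
def substSeq {A B : Type*} (π : A → B) : (ℕ → List (Option A)) → List B → List B
  | _, [] => []
  | y, x :: z => substWord π x (y 0) ++ substSeq π (fun n => y (n + 1)) z

/-- The semigroup of words under concatenation. -/
@[reducible] def wordSemigroup (A : Type*) : Semigroup (List A) where
  mul := List.append
  mul_assoc := List.append_assoc

section CarlsonSimpson

attribute [local instance] wordSemigroup Ultrafilter.semigroup

/-- The extension to ultrafilters of the letterwise map of words. -/
def ultraMap {A B : Type*} (f : A → B) : Ultrafilter (List A) →ₙ* Ultrafilter (List B) where
  toFun u := u.map (List.map f)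
  map_mul' u v := by
    refine Ultrafilter.coe_inj.mp (Filter.ext' fun s => ?_)
    change (∀ᶠ x in u, ∀ᶠ y in v, s (List.map f (x ++ y))) ↔
      ∀ᶠ x in u, ∀ᶠ y in v, s (List.map f x ++ List.map f y)
    simp only [List.map_append]

/-- The Carlson–Simpson theorem on left variable words. -/
theorem carlson_simpson {A κ : Type*} [Finite A] [Finite κ] (c : List A → κ) :
    ∃ (w : List A) (y : ℕ → List (Option A)) (k : κ), (∀ n, ∃ t, y n = none :: t) ∧
      ∀ a : List A, c (w ++ substSeq id y a) = k := by
  obtain ⟨p, hpp, hp⟩ := exists_minimal_idempotent (M := Ultrafilter (List A))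
    Ultrafilter.continuous_mul_left
  let φ : A → Ultrafilter (List (Option A)) →ₙ* Ultrafilter (List A) :=
    fun a => ultraMap fun o => o.elim a id
  obtain ⟨r, hr1, hr2⟩ := exists_absorbed_multiple (V := Ultrafilter (List (Option A)))
    Ultrafilter.continuous_mul_left φ p hpp hp (p.map (List.map some))
    (fun a => by
      change Ultrafilter.map _ (Ultrafilter.map _ p) = p
      rw [Ultrafilter.map_map]
      convert Ultrafilter.map_id p
      ext1 x
      simp [Function.comp_def]) (pure [none])
  set q := (pure [none] : Ultrafilter (List (Option A))) * r with hq
  have hleft : ∀ᶠ y in (q : Filter (List (Option A))), ∃ t, y = none :: t := by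
    rw [hq, Ultrafilter.eventually_mul]
    change ∀ᶠ m in pure [none], _
    rw [Filter.eventually_pure]
    exact Filter.Eventually.of_forall fun t => ⟨t, rfl⟩
  obtain ⟨k, hk⟩ : ∃ k, ∀ᶠ x in (p : Filter (List A)), c x = k := by
    obtain ⟨k, hk⟩ := Ultrafilter.eq_pure_of_finite (p.map c)
    refine ⟨k, ?_⟩
    have : {k} ∈ p.map c := by rw [hk]; exact Set.mem_singleton k
    exact this
  let Q : Set (List A) := {x | c x = k ∧ ∀ a, ∀ᶠ y in (q : Filter (List (Option A))),
    c (x ++ substWord id a y) = k}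
  have hQp : ∀ᶠ x in (p : Filter (List A)), x ∈ Q := by
    refine hk.and (Filter.eventually_all.2 fun a => ?_)
    have h := hk
    rw [← hr1 a] at h
    exact h
  have hQq : ∀ x ∈ Q, ∀ a, ∀ᶠ y in (q : Filter (List (Option A))),
      x ++ substWord id a y ∈ Q := by
    intro x hx a
    refine (hx.2 a).and (Filter.eventually_all.2 fun a' => ?_)
    have h : ∀ᶠ y in (φ a q : Filter (List A)), c (x ++ y) = k := hx.2 a
    rw [← hr2 a a'] at h
    have h' : ∀ᶠ y in (q : Filter (List (Option A))), ∀ᶠ y' in (q : Filter (List (Option A))),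
      c (x ++ (substWord id a y ++ substWord id a' y')) = k := h
    simpa only [List.append_assoc] using h'
  have hstep : ∀ X : {X : Set (List A) // X.Finite ∧ X ⊆ Q}, ∃ y : List (Option A),
      (∃ t, y = none :: t) ∧ ∀ x ∈ X.1, ∀ a, x ++ substWord id a y ∈ Q := by
    rintro ⟨X, hX, hXQ⟩
    refine (hleft.and ((Filter.eventually_all_finite hX).2 fun x hx =>
      Filter.eventually_all.2 fun a => hQq x (hXQ hx) a)).exists
  choose g hg1 hg2 using hstep
  obtain ⟨w, hw⟩ := hQp.exists
  let next : {X : Set (List A) // X.Finite ∧ X ⊆ Q} → {X : Set (List A) // X.Finite ∧ X ⊆ Q} :=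
    fun X => ⟨Set.image2 (fun x a => x ++ substWord id a (g X)) X.1 Set.univ,
      X.2.1.image2 _ Set.finite_univ, by
        rintro _ ⟨x, hx, a, -, rfl⟩
        exact hg2 X x hx a⟩
  let X : ℕ → {X : Set (List A) // X.Finite ∧ X ⊆ Q} :=
    fun n => n.rec ⟨{w}, Set.finite_singleton w, by simpa using hw⟩ fun _ => next
  refine ⟨w, fun n => g (X n), k, fun n => hg1 _, fun a => ?_⟩
  have key : ∀ (a : List A) (n : ℕ) (x : List A), x ∈ (X n).1 →
      c (x ++ substSeq id (fun m => g (X (m + n))) a) = k := by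
    intro a
    induction a with
    | nil =>
      intro n x hx
      simpa [substSeq] using ((X n).2.2 hx).1
    | cons a z ih =>
      intro n x hx
      have := ih (n + 1) (x ++ substWord id a (g (X n))) ⟨x, hx, a, Set.mem_univ _, rfl⟩
      simpa [substSeq, List.append_assoc, Nat.add_assoc, Nat.add_comm, Nat.add_left_comm] using this
  exact key a 0 w (Set.mem_singleton w)

end CarlsonSimpson

/-- `e` maps `b^{<ℕ}` into the sequences so that the `p`-th immediate successor of a node is
mapped to an extension of the image of the node in direction `p`. -/
def RespectsSuc {b : ℕ} (e : List (Fin b) → List ℕ) : Prop :=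
  ∀ (w : List (Fin b)) (p : Fin b), e w ++ [(p : ℕ)] <+: e (w ++ [p])

namespace RespectsSuc

variable {b : ℕ} {e : List (Fin b) → List ℕ}

theorem mono (he : RespectsSuc e) {v w : List (Fin b)} (h : v <+: w) : e v <+: e w := by
  obtain ⟨t, rfl⟩ := h
  induction t using List.reverseRecOn with
  | nil => simp
  | append_singleton t p ih =>
    rw [← List.append_assoc]
    exact ih.trans ((List.prefix_append _ _).trans (he _ p))

theorem append_prefix (he : RespectsSuc e) {v w : List (Fin b)} {p : Fin b}
    (h : v ++ [p] <+: w) : e v ++ [(p : ℕ)] <+: e w :=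
  (he v p).trans (he.mono h)

theorem append_val_inj {s t : List ℕ} {p q : Fin b} (hp : s ++ [(p : ℕ)] <+: t)
    (hq : s ++ [(q : ℕ)] <+: t) : p = q := by
  have := (List.prefix_of_prefix_length_le hp hq (by simp)).eq_of_length (by simp)
  simpa [Fin.ext_iff] using this

theorem exists_common_prefix {α : Type*} (v w : List α) : v <+: w ∨ w <+: v ∨
    ∃ u p q, p ≠ q ∧ u ++ [p] <+: v ∧ u ++ [q] <+: w := by
  induction v generalizing w with
  | nil => simp
  | cons x v ih =>
    cases w with
    | nil => simp
    | cons y w =>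
      by_cases hxy : x = y
      · subst hxy
        rcases ih w with h | h | ⟨u, p, q, hpq, hv, hw⟩
        · left; simpa using h
        · right; left; simpa using h
        · right; right
          exact ⟨x :: u, p, q, hpq, by simpa using hv, by simpa using hw⟩
      · right; right
        exact ⟨[], x, y, hxy, by simp, by simp⟩

theorem length_lt (he : RespectsSuc e) {v w : List (Fin b)} (h : v <+: w) (hne : v ≠ w) :
    (e v).length < (e w).length := by
  obtain ⟨t, rfl⟩ := h
  cases t with
  | nil => simp at hne
  | cons p t =>
    have := (he.append_prefix (v := v) (p := p) (w := v ++ p :: t) ⟨t, by simp⟩).length_le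
    simp at this
    omega

theorem prefix_iff (he : RespectsSuc e) {v w : List (Fin b)} : e v <+: e w ↔ v <+: w := by
  refine ⟨fun h => ?_, he.mono⟩
  rcases exists_common_prefix v w with h' | h' | ⟨u, p, q, hpq, hv, hw⟩
  · exact h'
  · by_cases hne : w = v
    · subst hne; exact h'
    · have := he.length_lt h' hne
      have := h.length_le
      omega
  · exact absurd (append_val_inj ((he.append_prefix hv).trans h) (he.append_prefix hw)) hpq

theorem injective (he : RespectsSuc e) : Function.Injective e := fun v w h =>
  (he.prefix_iff.1 (h ▸ List.prefix_rfl)).eq_of_length_le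
    (he.prefix_iff.1 (h ▸ List.prefix_rfl : e w <+: e v)).length_le

theorem append_prefix_iff (he : RespectsSuc e) {v w : List (Fin b)} {p : Fin b} :
    e v ++ [(p : ℕ)] <+: e w ↔ v ++ [p] <+: w := by
  refine ⟨fun h => ?_, he.append_prefix⟩
  obtain ⟨t, rfl⟩ := he.prefix_iff.1 ((List.prefix_append _ _).trans h)
  cases t with
  | nil =>
    have := h.length_le
    simp at this
  | cons q t =>
    have hq : v ++ [q] <+: v ++ q :: t := ⟨t, by simp⟩
    rwa [append_val_inj h (he.append_prefix hq)]

theorem ncard_strict_prefixes {α : Type*} (w : List α) :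
    {v | v <+: w ∧ v ≠ w}.ncard = w.length := by
  have : {v | v <+: w ∧ v ≠ w} = (fun k => w.take k) '' (Set.Iio w.length) := by
    ext v
    constructor
    · rintro ⟨h, hne⟩
      refine ⟨v.length, ?_, (List.prefix_iff_eq_take.1 h).symm⟩
      exact lt_of_le_of_ne h.length_le fun hl => hne (h.eq_of_length hl)
    · rintro ⟨k, hk, rfl⟩
      refine ⟨List.take_prefix _ _, fun h => ?_⟩
      have := congrArg List.length h
      simp at this hk
      omega
  rw [this, Set.InjOn.ncard_image]
  · rw [← Finset.coe_Iio, Set.ncard_coe_finset, Nat.card_Iio]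
  · intro i hi j hj h
    have := congrArg List.length h
    simp at this hi hj
    omega

theorem level_range (he : RespectsSuc e) (n : ℕ) :
    level (Set.range e) n = e '' {w | w.length = n} := by
  have key : ∀ w, {s ∈ Set.range e | s <+: e w ∧ s ≠ e w}.ncard = w.length := by
    intro w
    have : {s ∈ Set.range e | s <+: e w ∧ s ≠ e w} = e '' {v | v <+: w ∧ v ≠ w} := by
      ext s
      constructor
      · rintro ⟨⟨v, rfl⟩, h, hne⟩
        exact ⟨v, ⟨he.prefix_iff.1 h, fun h => hne (h ▸ rfl)⟩, rfl⟩
      · rintro ⟨v, ⟨h, hne⟩, rfl⟩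
        exact ⟨⟨v, rfl⟩, he.mono h, fun h => hne (he.injective h)⟩
    rw [this, Set.ncard_image_of_injective _ he.injective, ncard_strict_prefixes]
  ext s
  constructor
  · rintro ⟨⟨w, rfl⟩, h⟩
    exact ⟨w, (key w).symm.trans h, rfl⟩
  · rintro ⟨w, h, rfl⟩
    exact ⟨⟨w, rfl⟩, (key w).trans h⟩

theorem immSuc_range (he : RespectsSuc e) {w : List (Fin b)} {s : List ℕ} :
    ImmSuc (Set.range e) (e w) s ↔ ∃ p, s = e (w ++ [p]) := by
  constructor
  · rintro ⟨-, ⟨v, rfl⟩, h, hne, hmin⟩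
    obtain ⟨t, rfl⟩ := he.prefix_iff.1 h
    cases t with
    | nil => simp at hne
    | cons p t =>
      rcases hmin (e (w ++ [p])) ⟨_, rfl⟩ (he.mono (List.prefix_append _ _))
        (he.mono ⟨t, by simp⟩) with h | h
      · have := he.injective h
        simp at this
      · exact ⟨p, h.symm⟩
  · rintro ⟨p, rfl⟩
    refine ⟨⟨w, rfl⟩, ⟨_, rfl⟩, he.mono (List.prefix_append _ _), fun h => ?_, ?_⟩
    · have := he.injective h
      simp at this
    · rintro _ ⟨u, rfl⟩ h1 h2
      have h1 := he.prefix_iff.1 h1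
      have h2 := he.prefix_iff.1 h2
      have := h1.length_le
      have h3 := h2.length_le
      simp at h3
      rcases Nat.lt_or_ge w.length u.length with h | h
      · right
        rw [h2.eq_of_length (by simp; omega)]
      · left
        rw [h1.eq_of_length (by omega)]

end RespectsSuc

/-- `e` is an isomorphism of `b^{<ℕ}` onto the tree `T` that respects directions, and the nodes
of the `n`-th level of `T` are sequences of length `L n`. -/
structure IsCoding (b : ℕ) (T : Set (List ℕ)) (L : ℕ → ℕ) (e : List (Fin b) → List ℕ) :
    Prop where
  range_eq : Set.range e = T
  respects : RespectsSuc e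
  length_eq : ∀ w, (e w).length = L w.length

theorem isCoding_bSeq (b : ℕ) : IsCoding b (bSeq b) id (List.map Fin.val) where
  range_eq := by
    ext t
    constructor
    · rintro ⟨w, rfl⟩ x hx
      obtain ⟨p, -, rfl⟩ := List.mem_map.1 hx
      exact p.2
    · intro ht
      have ht' : ∀ x ∈ t, x < b := ht
      exact ⟨t.pmap Fin.mk ht', by simp [List.map_pmap]⟩
  respects := fun w p => by simp
  length_eq := fun w => by simp

namespace IsCoding

variable {b : ℕ} {T S : Set (List ℕ)} {L L' l : ℕ → ℕ} {e e' : List (Fin b) → List ℕ}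

theorem level_eq (h : IsCoding b T L e) (n : ℕ) : level T n = e '' {w | w.length = n} := by
  rw [← h.range_eq, h.respects.level_range]

theorem level_zero (h : IsCoding b T L e) : level T 0 = {e []} := by
  rw [h.level_eq]
  simp [List.length_eq_zero_iff]

theorem level_one (h : IsCoding b T L e) : level T 1 = Set.range fun p => e [p] := by
  rw [h.level_eq]
  ext s
  simp [List.length_eq_one_iff]

theorem immSuc_iff (h : IsCoding b T L e) {w : List (Fin b)} {s : List ℕ} :
    ImmSuc T (e w) s ↔ ∃ p, s = e (w ++ [p]) := by
  rw [← h.range_eq, h.respects.immSuc_range]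

theorem level_finite (h : IsCoding b T L e) (n : ℕ) : (level T n).Finite := by
  rw [h.level_eq]
  exact (List.finite_length_eq (Fin b) n).image _

theorem strictMono (h : IsCoding b T L e) (hb : 0 < b) : StrictMono L := by
  refine strictMono_nat_of_lt_succ fun n => ?_
  let w : List (Fin b) := List.replicate n ⟨0, hb⟩
  have := h.respects.length_lt (List.prefix_append w [⟨0, hb⟩]) (by simp)
  simpa [h.length_eq, w] using this

/-- Immediate successors in a coded tree are determined by their direction. -/
theorem isConcat_unique (h : IsCoding b T L e) {w s s' : List ℕ} {p : ℕ}
    (hs : IsConcat T w p s) (hs' : IsConcat T w p s') : s = s' := by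
  obtain ⟨v, rfl⟩ : w ∈ Set.range e := h.range_eq ▸ hs.1.1
  obtain ⟨q, rfl⟩ := h.immSuc_iff.1 hs.1
  obtain ⟨q', rfl⟩ := h.immSuc_iff.1 hs'.1
  have key : ∀ q : Fin b, e v ++ [p] <+: e (v ++ [q]) → p = q := by
    intro q hq
    have := (List.prefix_of_prefix_length_le hq (h.respects v q) (by simp)).eq_of_length (by simp)
    simpa using this
  have : q = q' := Fin.ext ((key q hs.2).symm.trans (key q' hs'.2))
  rw [this]

/-- A strong subtree of a coded tree is coded. -/
theorem exists_of_isStrongSubtreeWith (h : IsCoding b T L e) (hS : IsStrongSubtreeWith T S l) :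
    ∃ e', IsCoding b S (L ∘ l) e' := by
  obtain ⟨hST, ⟨r, hr, hruniq⟩, -, hlev, hsuc⟩ := hS
  have hchild : ∀ (s : S) (p : Fin b), ∃ s' : S, ImmSuc S s s' ∧ s.1 ++ [(p : ℕ)] <+: s' ∧
      ∀ s'', ImmSuc S s s'' → s.1 ++ [(p : ℕ)] <+: s'' → s'' = s' := by
    rintro ⟨s, hs⟩ p
    obtain ⟨v, rfl⟩ : s ∈ Set.range e := h.range_eq ▸ hST hs
    obtain ⟨s', ⟨hs', hp⟩, huniq⟩ := hsuc _ hs (e (v ++ [p])) (h.immSuc_iff.2 ⟨p, rfl⟩)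
    refine ⟨⟨s', hs'.2.1⟩, hs', (h.respects v p).trans hp, fun s'' hs'' hp'' => ?_⟩
    refine huniq _ ⟨hs'', ?_⟩
    obtain ⟨u, rfl⟩ : s'' ∈ Set.range e := h.range_eq ▸ hST hs''.2.1
    exact h.respects.mono (h.respects.append_prefix_iff.1 hp'')
  choose child hchild1 hchild2 hchild3 using hchild
  let e' : List (Fin b) → List ℕ := fun w => (w.foldl child ⟨r, hr.1⟩).1
  have he' : RespectsSuc e' := fun w p => by
    simp only [e', List.foldl_append, List.foldl_cons, List.foldl_nil]
    exact hchild2 _ p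
  have hrange : Set.range e' = S := by
    refine Set.Subset.antisymm ?_ ?_
    · rintro _ ⟨w, rfl⟩
      exact (w.foldl child ⟨r, hr.1⟩).2
    · intro s hs
      induction hn : s.length using Nat.strong_induction_on generalizing s with
      | _ n ih =>
      subst hn
      let pred : Set (List ℕ) := {u ∈ S | u <+: s ∧ u ≠ s}
      have hfin : pred.Finite :=
        (s.inits.toFinset.finite_toSet).subset fun u hu => by simpa using hu.2.1
      by_cases hempty : pred = ∅
      · refine ⟨[], (hruniq s ⟨hs, ?_⟩).symm⟩
        change pred.ncard = 0
        rw [hempty, Set.ncard_empty]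
      · obtain ⟨u, hu, hmax⟩ := Set.exists_max_image pred List.length hfin
          (Set.nonempty_iff_ne_empty.2 hempty)
        have hlt : u.length < s.length :=
          lt_of_le_of_ne hu.2.1.length_le fun hl => hu.2.2 (hu.2.1.eq_of_length hl)
        obtain ⟨w, rfl⟩ := ih _ hlt hu.1 rfl
        have himm : ImmSuc S (e' w) s := by
          refine ⟨hu.1, hs, hu.2.1, hu.2.2, fun x hx h1 h2 => ?_⟩
          by_cases hxs : x = s
          · exact Or.inr hxs
          · exact Or.inl (h1.eq_of_length_le (hmax x ⟨hx, h2, hxs⟩)).symm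
        obtain ⟨v, hv⟩ : e' w ∈ Set.range e := h.range_eq ▸ hST hu.1
        obtain ⟨v', rfl⟩ : s ∈ Set.range e := h.range_eq ▸ hST hs
        obtain ⟨t, rfl⟩ := h.respects.prefix_iff.1 (hv ▸ hu.2.1)
        cases t with
        | nil => exact absurd (by simpa using hv.symm) hu.2.2
        | cons p t =>
          refine ⟨w ++ [p], ?_⟩
          simp only [e', List.foldl_append, List.foldl_cons, List.foldl_nil]
          refine (hchild3 _ p _ himm ?_).symm
          change e' w ++ _ <+: _
          rw [← hv]
          exact h.respects.append_prefix ⟨t, by simp⟩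
  refine ⟨e', hrange, he', fun w => ?_⟩
  have hw : e' w ∈ level S w.length := by
    rw [← hrange, he'.level_range]
    exact ⟨w, rfl, rfl⟩
  have := hlev _ hw
  rw [h.level_eq] at this
  obtain ⟨v, hv, hvw⟩ := this
  rw [← hvw, h.length_eq, hv]
  rfl

/-- A coded subset of a coded tree with compatible lengths is a strong subtree. -/
theorem isStrongSubtreeWith (hT : IsCoding b T L e) (hS : IsCoding b S (L ∘ l) e')
    (hb : 0 < b) (hST : S ⊆ T) (hl : StrictMono l) : IsStrongSubtreeWith T S l := by
  refine ⟨hST, ⟨e' [], ?_, ?_⟩, hl, ?_, ?_⟩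
  · simp [hS.level_zero]
  · simp [hS.level_zero]
  · intro n
    rw [hS.level_eq, hT.level_eq]
    rintro _ ⟨w, rfl, rfl⟩
    obtain ⟨v, hv⟩ : e' w ∈ Set.range e := hT.range_eq ▸ hST (hS.range_eq ▸ ⟨w, rfl⟩)
    refine ⟨v, (hT.strictMono hb).injective ?_, hv⟩
    rw [← hT.length_eq, hv, hS.length_eq]
    rfl
  · intro s hs t ht
    obtain ⟨w, rfl⟩ : s ∈ Set.range e' := hS.range_eq ▸ hs
    obtain ⟨v, hv⟩ : e' w ∈ Set.range e := hT.range_eq ▸ hST hs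
    rw [← hv] at ht
    obtain ⟨p, rfl⟩ := hT.immSuc_iff.1 ht
    refine ⟨e' (w ++ [p]), ⟨hS.immSuc_iff.2 ⟨p, rfl⟩, ?_⟩, ?_⟩
    · obtain ⟨v', hv'⟩ : e' (w ++ [p]) ∈ Set.range e :=
        hT.range_eq ▸ hST (hS.range_eq ▸ ⟨_, rfl⟩)
      have := hS.respects w p
      rw [← hv, ← hv'] at this
      rw [← hv']
      exact hT.respects.mono (hT.respects.append_prefix_iff.1 this)
    · rintro _ ⟨hs', htp⟩
      obtain ⟨q, rfl⟩ := hS.immSuc_iff.1 hs'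
      have h1 := (hT.respects v p).trans htp
      rw [hv] at h1
      rw [RespectsSuc.append_val_inj h1 (hS.respects w q)]

end IsCoding

theorem IsHomogeneous.exists_isCoding {b : ℕ} {T : Set (List ℕ)} (h : IsHomogeneous b T) :
    ∃ L e, IsCoding b T L e := by
  obtain ⟨-, l, hl⟩ := h
  exact ⟨_, (isCoding_bSeq b).exists_of_isStrongSubtreeWith hl⟩

/-- A family of codings of the components of a vector tree. -/
def IsVecCoding {d : ℕ} (b : Fin d → ℕ) (T : Fin d → Set (List ℕ)) (L : Fin d → ℕ → ℕ)
    (e : ∀ i, List (Fin (b i)) → List ℕ) : Prop :=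
  ∀ i, 0 < b i ∧ IsCoding (b i) (T i) (L i) (e i)

theorem IsVecHomogeneous.exists_isVecCoding {d : ℕ} {b : Fin d → ℕ} {T : Fin d → Set (List ℕ)}
    (h : IsVecHomogeneous b T) : ∃ L e, IsVecCoding b T L e := by
  choose L e he using fun i => (h i).exists_isCoding
  exact ⟨L, e, fun i => ⟨by have := (h i).1; omega, he i⟩⟩

theorem IsCoding.level_fan {b : ℕ} {R : Set (List ℕ)} {L : ℕ → ℕ} {e : List (Fin b) → List ℕ}
    (h : IsCoding b R L e) :
    level (level R 0 ∪ level R 1) 0 = {e []} ∧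
      level (level R 0 ∪ level R 1) 1 = Set.range fun p => e [p] := by
  rw [h.level_zero, h.level_one]
  set F : Set (List ℕ) := {e []} ∪ Set.range fun p => e [p]
  have hroot : {s ∈ F | s <+: e [] ∧ s ≠ e []}.ncard = 0 := by
    have : {s ∈ F | s <+: e [] ∧ s ≠ e []} = ∅ := by
      refine Set.eq_empty_of_forall_notMem ?_
      rintro s ⟨rfl | ⟨p, rfl⟩, hs, hne⟩
      · exact hne rfl
      · have := h.respects.prefix_iff.1 hs
        simp at this
    rw [this, Set.ncard_empty]
  have hleaf : ∀ p, {s ∈ F | s <+: e [p] ∧ s ≠ e [p]}.ncard = 1 := by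
    intro p
    have : {s ∈ F | s <+: e [p] ∧ s ≠ e [p]} = {e []} := by
      ext s
      constructor
      · rintro ⟨rfl | ⟨q, rfl⟩, hs, hne⟩
        · rfl
        · have := h.respects.prefix_iff.1 hs
          simp at this
          subst this
          exact absurd rfl hne
      · rintro rfl
        refine ⟨Or.inl rfl, h.respects.mono (by simp), fun h' => ?_⟩
        have := h.respects.injective h'
        simp at this
    rw [this, Set.ncard_singleton]
  constructor
  · ext s
    constructor
    · rintro ⟨rfl | ⟨p, rfl⟩, hs⟩
      · rfl
      · have := (hleaf p).symm.trans hs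
        omega
    · rintro rfl
      exact ⟨Or.inl rfl, hroot⟩
  · ext s
    constructor
    · rintro ⟨rfl | ⟨p, rfl⟩, hs⟩
      · have := hroot.symm.trans hs
        omega
      · exact ⟨p, rfl⟩
    · rintro ⟨p, rfl⟩
      exact ⟨Or.inr ⟨p, rfl⟩, hleaf p⟩

namespace IsVecCoding

variable {d : ℕ} {b : Fin d → ℕ} {T S R F : Fin d → Set (List ℕ)} {L : Fin d → ℕ → ℕ}
  {e : ∀ i, List (Fin (b i)) → List ℕ}

theorem exists_of_isVecStrongSubtree (h : IsVecCoding b T L e) (hS : IsVecStrongSubtree T S) :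
    ∃ (l : ℕ → ℕ) (e' : ∀ i, List (Fin (b i)) → List ℕ),
      IsVecCoding b S (fun i => L i ∘ l) e' ∧ (∀ i, IsStrongSubtreeWith (T i) (S i) l) := by
  obtain ⟨l, hl⟩ := hS
  choose e' he' using fun i => (h i).2.exists_of_isStrongSubtreeWith (hl i)
  exact ⟨l, e', fun i => ⟨(h i).1, he' i⟩, hl⟩

theorem isVecStrongSubtree_trans (h : IsVecCoding b T L e) (hS : IsVecStrongSubtree T S)
    (hR : IsVecStrongSubtree S R) : IsVecStrongSubtree T R := by
  obtain ⟨l, e', he', hl⟩ := h.exists_of_isVecStrongSubtree hS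
  obtain ⟨l', e'', he'', hl'⟩ := he'.exists_of_isVecStrongSubtree hR
  exact ⟨l ∘ l', fun i => (h i).2.isStrongSubtreeWith (he'' i).2 (h i).1
    ((hl' i).1.trans (hl i).1) ((hl i).2.2.1.comp (hl' i).2.2.1)⟩

theorem isVecFan_trans (h : IsVecCoding b T L e) (hS : IsVecStrongSubtree T S)
    (hF : IsVecFan S F) : IsVecFan T F := by
  obtain ⟨R, hR, hFR⟩ := hF
  exact ⟨R, h.isVecStrongSubtree_trans hS hR, hFR⟩

/-- The first level of a vector fan of a coded vector tree picks one node of a common level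
above each immediate successor of each component of the root. -/
theorem exists_of_isVecFan (h : IsVecCoding b T L e) (hF : IsVecFan T F) :
    ∃ (n : ℕ) (r : ∀ i, List (Fin (b i))) (z : ∀ i, Fin (b i) → List (Fin (b i))),
      (∀ i p, (z i p).length = n ∧ r i ++ [p] <+: z i p) ∧
      (∀ i, level (F i) 0 = {e i (r i)}) ∧
      (∀ i, level (F i) 1 = Set.range fun p => e i (z i p)) ∧
      ∀ i, F i = {e i (r i)} ∪ Set.range fun p => e i (z i p) := by
  obtain ⟨R, hR, hFR⟩ := hF
  obtain ⟨l, e', he', hl⟩ := h.exists_of_isVecStrongSubtree hR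
  have hmem : ∀ i w, ∃ v, e i v = e' i w := fun i w => by
    have : e' i w ∈ Set.range (e i) :=
      (h i).2.range_eq ▸ (hl i).1 ((he' i).2.range_eq ▸ ⟨w, rfl⟩)
    exact this
  choose v hv using hmem
  refine ⟨l 1, fun i => v i [], fun i p => v i [p], fun i p => ⟨?_, ?_⟩, fun i => ?_, fun i => ?_,
    fun i => ?_⟩
  · refine ((h i).2.strictMono (h i).1).injective ?_
    rw [← (h i).2.length_eq, hv, (he' i).2.length_eq]
    rfl
  · rw [← (h i).2.respects.append_prefix_iff, hv, hv]
    exact (he' i).2.respects [] p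
  · rw [hFR, (he' i).2.level_fan.1, hv]
  · rw [hFR, (he' i).2.level_fan.2]
    simp only [hv]
  · rw [hFR, (he' i).2.level_zero, (he' i).2.level_one]
    simp only [hv]

theorem vecLevel_one_nonempty (h : IsVecCoding b T L e) (hF : IsVecFan T F) (i : Fin d)
    {x : List ℕ} (hx : x ∈ level (F i) 1) : ∃ v ∈ vecLevel F 1, v i = x := by
  obtain ⟨n, r, z, -, -, h1, -⟩ := h.exists_of_isVecFan hF
  refine ⟨Function.update (fun j => e j (z j ⟨0, (h j).1⟩)) i x, fun j => ?_, by simp⟩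
  by_cases hj : j = i
  · subst hj
    simpa using hx
  · rw [Function.update_of_ne hj, h1]
    exact ⟨_, rfl⟩

theorem level_subset_of_vecLevel_subset (h : IsVecCoding b T L e) (hF : IsVecFan T F) {m : ℕ}
    {U : Fin d → Set (List ℕ)} (hm : vecLevel F 1 ⊆ vecLevel U m) (i : Fin d) :
    level (F i) 1 ⊆ level (U i) m := by
  intro x hx
  obtain ⟨v, hv, rfl⟩ := h.vecLevel_one_nonempty hF i hx
  exact hm hv i

theorem vecLevel_subset_unique (h : IsVecCoding b T L e) (hF : IsVecFan T F) (i : Fin d)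
    {m m' : ℕ} (hm : vecLevel F 1 ⊆ vecLevel T m) (hm' : vecLevel F 1 ⊆ vecLevel T m') :
    m = m' := by
  obtain ⟨n, r, z, -, -, h1, -⟩ := h.exists_of_isVecFan hF
  have hx : e i (z i ⟨0, (h i).1⟩) ∈ level (F i) 1 := by
    rw [h1]
    exact ⟨_, rfl⟩
  exact (h.level_subset_of_vecLevel_subset hF hm i hx).2.symm.trans
    (h.level_subset_of_vecLevel_subset hF hm' i hx).2

theorem fanAt_finite (h : IsVecCoding b T L e) (n : ℕ) : (fanAt T n).Finite := by
  refine (Set.Finite.pi' fun i =>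
    ((List.finite_length_le (Fin (b i)) n).image (e i)).finite_subsets).subset ?_
  rintro F ⟨hF, hn⟩ i
  obtain ⟨k, r, z, hz, -, h1, hFi⟩ := h.exists_of_isVecFan hF
  have hlen : ∀ p, (z i p).length = n := by
    intro p
    have hx : e i (z i p) ∈ level (T i) n :=
      h.level_subset_of_vecLevel_subset hF hn i (by rw [h1]; exact ⟨p, rfl⟩)
    rw [(h i).2.level_eq] at hx
    obtain ⟨v, hv, hvz⟩ := hx
    rw [← (h i).2.respects.injective hvz]
    exact hv
  change F i ⊆ _
  rw [hFi]
  rintro _ (rfl | ⟨p, rfl⟩)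
  · refine ⟨r i, ?_, rfl⟩
    have h2 := (hz i ⟨0, (h i).1⟩).2.length_le
    rw [hlen] at h2
    simp at h2
    exact le_of_lt h2
  · exact ⟨z i p, (hlen p).le, rfl⟩

end IsVecCoding

theorem substSeq_append_singleton {A B : Type*} (π : A → B) (y : ℕ → List (Option A))
    (z : List B) (x : B) :
    substSeq π y (z ++ [x]) = substSeq π y z ++ substWord π x (y z.length) := by
  induction z generalizing y with
  | nil => simp [substSeq]
  | cons a z ih => simp [substSeq, ih]

theorem map_substSeq {A B : Type*} (π : A → B) (y : ℕ → List (Option A)) (a : List A) :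
    (substSeq id y a).map π = substSeq π y (a.map π) := by
  induction a generalizing y with
  | nil => rfl
  | cons x a ih =>
    simp only [substSeq, List.map_append, List.map_cons, ih]
    congr 1
    simp only [substWord, List.map_map]
    refine List.map_congr_left fun o _ => ?_
    cases o <;> rfl

theorem length_substSeq {A B : Type*} (π : A → B) (y : ℕ → List (Option A)) (z : List B) :
    (substSeq π y z).length = ∑ j ∈ Finset.range z.length, (y j).length := by
  induction z generalizing y with
  | nil => rfl
  | cons x z ih =>
    rw [substSeq, List.length_append, ih, List.length_cons, Finset.sum_range_succ', substWord,
      List.length_map, add_comm]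

/-- The level set of the subtree generated by a word and a sequence of variable words. -/
def wordLevels {A : Type*} (w : List A) (y : ℕ → List (Option A)) : ℕ → ℕ
  | 0 => 0
  | n + 1 => 1 + w.length + ∑ j ∈ Finset.range n, (y j).length

/-- The coding of the subtree generated by a word and a sequence of variable words; above the
immediate successor `p` of the root the letters are projected by `π p`. -/
def wordCoding {b : ℕ} {A : Type*} (e : List (Fin b) → List ℕ) (π : Fin b → A → Fin b)
    (w : List A) (y : ℕ → List (Option A)) : List (Fin b) → List ℕ
  | [] => e []
  | p :: z => e (p :: (w.map (π p) ++ substSeq (π p) y z))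

theorem wordLevels_strictMono {A : Type*} (w : List A) {y : ℕ → List (Option A)}
    (hy : ∀ n, ∃ t, y n = none :: t) : StrictMono (wordLevels w y) := by
  refine strictMono_nat_of_lt_succ fun n => ?_
  cases n with
  | zero => simp [wordLevels]
  | succ n =>
    obtain ⟨t, ht⟩ := hy n
    simp [wordLevels, Finset.sum_range_succ, ht]

theorem IsCoding.wordCoding {b : ℕ} {S : Set (List ℕ)} {L : ℕ → ℕ} {e : List (Fin b) → List ℕ}
    (h : IsCoding b S L e) {A : Type*} (π : Fin b → A → Fin b) (w : List A)
    {y : ℕ → List (Option A)} (hy : ∀ n, ∃ t, y n = none :: t) :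
    IsCoding b (Set.range (wordCoding e π w y)) (L ∘ wordLevels w y) (wordCoding e π w y) where
  range_eq := rfl
  respects := fun v p => by
    cases v with
    | nil => exact h.respects.append_prefix (by simp)
    | cons q z =>
      obtain ⟨t, ht⟩ := hy z.length
      refine h.respects.append_prefix ⟨substWord (π q) p t, ?_⟩
      simp [substSeq_append_singleton, ht, substWord]
  length_eq := fun v => by
    cases v with
    | nil => simp [DHLPaper.wordCoding, wordLevels, h.length_eq]
    | cons q z =>
      simp only [DHLPaper.wordCoding, h.length_eq, List.length_cons, List.length_append,
        List.length_map, length_substSeq, Function.comp, wordLevels]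
      congr 1
      omega

/-- The vector fan with root `(e i [])` selected by a word over the alphabet of all tuples of
self-maps of the alphabets `Fin (b i)`. -/
def wordFan {d : ℕ} {b : Fin d → ℕ} (e : ∀ i, List (Fin (b i)) → List ℕ)
    (u : List (∀ i, Fin (b i) → Fin (b i))) (i : Fin d) : Set (List ℕ) :=
  {e i []} ∪ Set.range fun p => e i (p :: u.map fun f => f i p)

/-- The vector subtree generated by a word and a sequence of variable words. -/
def wordTree {d : ℕ} {b : Fin d → ℕ} (e : ∀ i, List (Fin (b i)) → List ℕ)
    (w : List (∀ i, Fin (b i) → Fin (b i)))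
    (y : ℕ → List (Option (∀ i, Fin (b i) → Fin (b i)))) (i : Fin d) : Set (List ℕ) :=
  Set.range (wordCoding (e i) (fun p f => f i p) w y)

namespace IsVecCoding

variable {d : ℕ} {b : Fin d → ℕ} {S : Fin d → Set (List ℕ)} {L : Fin d → ℕ → ℕ}
  {e : ∀ i, List (Fin (b i)) → List ℕ}

theorem isVecCoding_wordTree (h : IsVecCoding b S L e) (w : List (∀ i, Fin (b i) → Fin (b i)))
    {y : ℕ → List (Option (∀ i, Fin (b i) → Fin (b i)))} (hy : ∀ n, ∃ t, y n = none :: t) :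
    IsVecCoding b (wordTree e w y) (fun i => L i ∘ wordLevels w y)
      (fun i => wordCoding (e i) (fun p f => f i p) w y) :=
  fun i => ⟨(h i).1, (h i).2.wordCoding _ w hy⟩

theorem isStrongSubtreeWith_wordTree (h : IsVecCoding b S L e)
    (w : List (∀ i, Fin (b i) → Fin (b i)))
    {y : ℕ → List (Option (∀ i, Fin (b i) → Fin (b i)))} (hy : ∀ n, ∃ t, y n = none :: t)
    (i : Fin d) : IsStrongSubtreeWith (S i) (wordTree e w y i) (wordLevels w y) := by
  refine (h i).2.isStrongSubtreeWith (h.isVecCoding_wordTree w hy i).2 (h i).1 ?_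
    (wordLevels_strictMono w hy)
  rintro _ ⟨v, rfl⟩
  rw [← (h i).2.range_eq]
  cases v with
  | nil => exact ⟨_, rfl⟩
  | cons p z => exact ⟨_, rfl⟩

/-- Every fan through the root of the subtree generated by a word and a sequence of variable
words is selected by a word obtained by substitution. -/
theorem exists_eq_wordFan (h : IsVecCoding b S L e) (w : List (∀ i, Fin (b i) → Fin (b i)))
    {y : ℕ → List (Option (∀ i, Fin (b i) → Fin (b i)))} (hy : ∀ n, ∃ t, y n = none :: t)
    {F : Fin d → Set (List ℕ)} (hF : IsVecFan (wordTree e w y) F)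
    (hroot : IsRoot F fun i => e i []) :
    ∃ a, F = wordFan e (w ++ substSeq id y a) := by
  have hR := h.isVecCoding_wordTree w hy
  obtain ⟨n, r, z, hz, h0, -, hFi⟩ := hR.exists_of_isVecFan hF
  have hr : ∀ i, r i = [] := fun i => by
    have h1 := (h0 i).symm.trans (hroot i)
    exact (hR i).2.respects.injective (Set.singleton_injective h1)
  have hcons : ∀ i p, ∃ t, z i p = p :: t := fun i p => by
    obtain ⟨t, ht⟩ := (hz i p).2
    exact ⟨t, by rw [← ht, hr]; rfl⟩
  choose t ht using hcons
  have hlen : ∀ i p, (t i p).length = n - 1 := fun i p => by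
    have := (hz i p).1
    rw [ht, List.length_cons] at this
    omega
  let a : List (∀ i, Fin (b i) → Fin (b i)) :=
    List.ofFn fun (j : Fin (n - 1)) i p => (t i p).get (j.cast (hlen i p).symm)
  have ha : ∀ i p, a.map (fun f => f i p) = t i p := fun i p => by
    refine List.ext_getElem (by simp [a, hlen]) fun k hk hk' => ?_
    simp [a]
  refine ⟨a, funext fun i => ?_⟩
  rw [hFi, wordFan, hr]
  congr 2
  funext p
  rw [ht, wordCoding, List.map_append, map_substSeq, ha]

theorem fanAt_nonempty (h : IsVecCoding b S L e) {n : ℕ} (hn : 1 ≤ n) : (fanAt S n).Nonempty := by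
  let w : List (∀ i, Fin (b i) → Fin (b i)) := List.replicate (n - 1) fun _ p => p
  have hy : ∀ _ : ℕ, ∃ t : List (Option (∀ i, Fin (b i) → Fin (b i))), [none] = none :: t :=
    fun _ => ⟨[], rfl⟩
  let R := wordTree e w fun _ => [none]
  have hR := h.isStrongSubtreeWith_wordTree w hy
  refine ⟨fun i => level (R i) 0 ∪ level (R i) 1, ⟨R, ⟨_, hR⟩, fun i => rfl⟩, fun v hv i => ?_⟩
  have hvi := hv i
  have hc := (h.isVecCoding_wordTree w hy i).2
  rw [hc.level_fan.2, ← hc.level_one] at hvi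
  have := (hR i).2.2.2.1 1 hvi
  have hl : wordLevels w (fun _ => [none]) 1 = n := by
    simp [wordLevels, w]
    omega
  rwa [hl] at this

end IsVecCoding

/-- under hypothesis (H), every vector strong subtree admits a fan through
its root together with a direction map `φ` making all relative densities at most
`θ_n = ε / (2 b_W Θ_n)`. -/
theorem sparse_fan_exists (d : ℕ) (b : Fin d → ℕ) (T : Fin d → Set (List ℕ))
    (hT : IsVecHomogeneous b T)
    (bW : ℕ) (W : Set (List ℕ)) (hW : IsHomogeneous bW W)
    (ε : ℝ) (hε0 : 0 < ε) (hε1 : ε ≤ 1)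
    (l : ℕ → ℕ) (D : (Fin d → List ℕ) → Set (List ℕ)) (hD : IsDenseLevelSel T W l ε D)
    (hH : ∀ (R : Fin d → Set (List ℕ)) (r0 : Fin d → List ℕ) (w : List ℕ) (θ : ℝ),
      IsVecStrongSubtree T R → IsRoot R r0 → w ∈ W → 0 < θ → θ ≤ 1 →
        ¬ StronglyCorrelated T W bW l D R r0 w θ) :
    ∀ n, 1 ≤ n → ∀ S : Fin d → Set (List ℕ), IsVecStrongSubtree T S →
      ∀ s0 : Fin d → List ℕ, IsRoot S s0 →
        ∃ F : Fin d → Set (List ℕ), IsVecFan S F ∧ IsRoot F s0 ∧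
          ∃ φ : List ℕ → ℕ, (∀ w ∈ D s0, φ w < bW) ∧
            ∀ w ∈ D s0, ∀ m, vecLevel F 1 ⊆ vecLevel T m →
              ∀ s, IsConcat W w (φ w) s →
                densRel W (l m) (⋂ t ∈ vecLevel F 1, D t) s
                  ≤ ε / (2 * (bW : ℝ) * ((fanAt T n).ncard : ℝ)) := by
  intro n hn S hS s0 hs0
  obtain ⟨LT, eT, hcT⟩ := hT.exists_isVecCoding
  obtain ⟨lS, eS, hcS, hlS⟩ := hcT.exists_of_isVecStrongSubtree hS
  obtain ⟨LW, eW, hcW⟩ := hW.exists_isCoding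
  have hroot : s0 = fun i => eS i [] := funext fun i =>
    Set.singleton_injective ((hs0 i).symm.trans (hcS i).2.level_zero)
  have hd : 0 < d := by
    rcases Nat.eq_zero_or_pos d with rfl | hd
    · exfalso
      have h0 := hD.2 0 s0 fun i => i.elim0
      have h1 := hD.2 1 s0 fun i => i.elim0
      have hempty : D s0 = ∅ := Set.eq_empty_of_forall_notMem fun w hw =>
        (hD.1 Nat.zero_lt_one).ne ((h0.1 hw).2.symm.trans (h1.1 hw).2)
      have := h0.2
      simp only [dens, hempty, Set.ncard_empty, Nat.cast_zero, zero_div] at this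
      linarith
    · exact hd
  have hDs0 : D s0 ⊆ level W (l (lS 0)) := (hD.2 (lS 0) s0 fun i =>
    (hlS i).2.2.2.1 0 (by rw [hs0 i]; exact Set.mem_singleton _)).1
  have hfin : Finite (D s0) := ((hcW.level_finite _).subset hDs0).to_subtype
  set θ : ℝ := ε / (2 * (bW : ℝ) * ((fanAt T n).ncard : ℝ))
  have hden : (1 : ℝ) ≤ 2 * (bW : ℝ) * ((fanAt T n).ncard : ℝ) := by
    have h1 : 1 ≤ (fanAt T n).ncard :=
      (Set.ncard_pos (hcT.fanAt_finite n)).2 (hcT.fanAt_nonempty hn)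
    have h2 := hW.1
    have h3 : 1 ≤ 2 * bW * (fanAt T n).ncard := Nat.mul_pos (by omega) h1
    exact_mod_cast h3
  have hθ0 : 0 < θ := div_pos hε0 (by linarith)
  have hθ1 : θ ≤ 1 := (div_le_one (by linarith)).2 (hε1.trans hden)
  let good : (Fin d → Set (List ℕ)) → List ℕ → ℕ → Prop := fun F w p =>
    ∀ m, vecLevel F 1 ⊆ vecLevel T m → ∀ s, IsConcat W w p s →
      densRel W (l m) (⋂ t ∈ vecLevel F 1, D t) s ≤ θ
  let color : List (∀ i, Fin (b i) → Fin (b i)) → Set (D s0) := fun u =>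
    {w | ∃ p < bW, good (wordFan eS u) w p}
  obtain ⟨w0, y, k, hy, hk⟩ := carlson_simpson color
  have hRS : IsVecStrongSubtree S (wordTree eS w0 y) :=
    ⟨_, hcS.isStrongSubtreeWith_wordTree w0 hy⟩
  have hRT := hcT.isVecStrongSubtree_trans hS hRS
  have hcR := hcS.isVecCoding_wordTree w0 hy
  have hRroot : IsRoot (wordTree eS w0 y) s0 := fun i => by
    rw [(hcR i).2.level_zero, hroot]
    rfl
  have hall : ∀ w, w ∈ k := by
    by_contra! hne
    obtain ⟨w, hw⟩ := hne
    refine hH _ s0 w θ hRT hRroot (hDs0 w.2).1 hθ0 hθ1 ⟨w.2, fun F hF hF0 m hm p hp s hs => ?_⟩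
    obtain ⟨a, rfl⟩ := hcS.exists_eq_wordFan w0 hy hF (hroot ▸ hF0)
    rw [← hk a] at hw
    have hbad : ¬ good (wordFan eS (w0 ++ substSeq id y a)) w p := fun h => hw ⟨p, hp, h⟩
    simp only [good, not_forall, not_le] at hbad
    obtain ⟨m', hm', s', hs', hlt⟩ := hbad
    rw [hcT.vecLevel_subset_unique (hcT.isVecFan_trans hRT hF) ⟨0, hd⟩ hm hm',
      hcW.isConcat_unique hs hs']
    exact hlt.le
  let F : Fin d → Set (List ℕ) := fun i =>
    level (wordTree eS w0 y i) 0 ∪ level (wordTree eS w0 y i) 1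
  have hFR : IsVecFan (wordTree eS w0 y) F := ⟨wordTree eS w0 y,
    ⟨id, fun i => (hcR i).2.isStrongSubtreeWith (l := id) (hcR i).2 (hcR i).1 subset_rfl
      strictMono_id⟩, fun i => rfl⟩
  have hF0 : IsRoot F s0 := fun i => by
    rw [(hcR i).2.level_fan.1, hroot]
    rfl
  obtain ⟨a, ha⟩ := hcS.exists_eq_wordFan w0 hy hFR (hroot ▸ hF0)
  have hφ : ∀ w : D s0, ∃ p < bW, good F w p := fun w => by
    have := hall w
    rw [← hk a] at this
    rw [ha]
    exact this
  choose φ hφ1 hφ2 using hφ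
  classical
  refine ⟨F, hcS.isVecFan_trans hRS hFR, hF0, fun w => if hw : w ∈ D s0 then φ ⟨w, hw⟩ else 0,
    fun w hw => ?_, fun w hw m hm s hs => ?_⟩
  · simpa [hw] using hφ1 ⟨w, hw⟩
  · simp only [hw, dif_pos] at hs
    exact hφ2 ⟨w, hw⟩ m hm s hs
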